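/- Let $V$ be a separable Hilbert space, $H\in(1/2,1)$, $-\infty\le\alpha<\beta\le\infty$, and let $f(t,x,\theta)$ be a $V$-valued function on $\mathbb{R}\times\mathbb{R}^d\times(\alpha,\beta)$, jointly measurable, infinitely differentiable with compact support in $(t,x)$ (as a function with values in $L^{1/H}((\alpha,\beta);V)$), and suppose $f(t,x,\theta)=0$ whenever $t\notin(-12,12)$. Then for every $(t,x)\in Q_0$: $\int_{Q_0}|\mathcal{G}f(s,y)|^2\,ds\,dy\;\le\;N\,\mathbb{M}_t\big[F_f(\cdot,x)\big](t),$ where $N$ depends only on $d$ and $F_f(t,x):=\left(\int_\alpha^\beta\big(\mathbb{M}_x[\|f(t,\cdot,\theta)\|_V^2](x)\big)^{1/(2H)}\,d\theta\right)^{2H}$. -/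

import Mathlib

open MeasureTheory ENNReal

/-- The heat kernel `G_t(x) = (4πt)^{-d/2} exp(-|x|²/(4t))` on `ℝ^d`. -/
noncomputable def heatKernel (d : ℕ) (t : ℝ) (x : EuclideanSpace ℝ (Fin d)) : ℝ :=
  (4 * Real.pi * t) ^ (-(d : ℝ)/2) * Real.exp (-‖x‖^2 / (4*t))

/-- The heat semigroup `T_t h (x) = ∫_{ℝ^d} h(x-y) G_t(y) dy` (Bochner integral). -/
noncomputable def heatOp (d : ℕ) {V : Type*} [NormedAddCommGroup V] [NormedSpace ℝ V]
    [CompleteSpace V] (t : ℝ) (h : EuclideanSpace ℝ (Fin d) → V)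
    (x : EuclideanSpace ℝ (Fin d)) : V :=
  ∫ y, heatKernel d t y • h (x - y)

/-- Squared norm of the spatial gradient of `T_t h` at `x`:
`‖∇ T_t h(x)‖² = ∑_{j=1}^d ‖∂_{x_j} T_t h(x)‖²`. -/
noncomputable def gradHeatNormSq (d : ℕ) {V : Type*} [NormedAddCommGroup V]
    [NormedSpace ℝ V] [CompleteSpace V] (t : ℝ) (h : EuclideanSpace ℝ (Fin d) → V)
    (x : EuclideanSpace ℝ (Fin d)) : ℝ :=
  ∑ j : Fin d, ‖fderiv ℝ (heatOp d t h) x (EuclideanSpace.single j 1)‖^2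

/-- The square-function operator
`𝒢f(t,x) = [∫_{-∞}^t (∫_α^β ‖∇T_{t-s}f(s,·,θ)(x)‖^{1/H} dθ)^{2H} ds]^{1/2}`
(note `‖∇T_{t-s}f(s,·,θ)(x)‖^{1/H} = (gradHeatNormSq ...)^{1/(2H)}`). -/
noncomputable def calG (d : ℕ) {V : Type*} [NormedAddCommGroup V] [NormedSpace ℝ V]
    [CompleteSpace V] (H : ℝ) (α β : EReal)
    (f : ℝ → EuclideanSpace ℝ (Fin d) → ℝ → V)
    (t : ℝ) (x : EuclideanSpace ℝ (Fin d)) : ℝ :=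
  (∫ s in Set.Iio t,
      (∫ θ in {θ : ℝ | α < (θ : EReal) ∧ (θ : EReal) < β},
        (gradHeatNormSq d (t - s) (fun y => f s y θ) x) ^ (1/(2*H))) ^ (2*H))
    ^ ((1:ℝ)/2)

/-- Hardy–Littlewood maximal function over balls in `ℝ^d`:
`𝕄_x g(x) = sup_{r>0} |B_r|⁻¹ ∫_{B_r(x)} |g(y)| dy`. -/
noncomputable def maxX (d : ℕ) (g : EuclideanSpace ℝ (Fin d) → ℝ)
    (x : EuclideanSpace ℝ (Fin d)) : ℝ≥0∞ :=
  ⨆ (r : ℝ) (_ : 0 < r),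
    (volume (Metric.ball x r))⁻¹ * ∫⁻ y in Metric.ball x r, ENNReal.ofReal |g y|

/-- Hardy–Littlewood maximal function over intervals in `ℝ`:
`𝕄_t k(t) = sup_{r>0} (2r)⁻¹ ∫_{t-r}^{t+r} |k(s)| ds`. -/
noncomputable def maxT (k : ℝ → ℝ≥0∞) (t : ℝ) : ℝ≥0∞ :=
  ⨆ (r : ℝ) (_ : 0 < r),
    (ENNReal.ofReal (2*r))⁻¹ * ∫⁻ s in Set.Ioo (t - r) (t + r), k s

/-- `F_f(t,x) = (∫_α^β (𝕄_x[‖f(t,·,θ)‖²](x))^{1/(2H)} dθ)^{2H}`. -/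
noncomputable def Ff (d : ℕ) {V : Type*} [NormedAddCommGroup V] (H : ℝ) (α β : EReal)
    (f : ℝ → EuclideanSpace ℝ (Fin d) → ℝ → V)
    (t : ℝ) (x : EuclideanSpace ℝ (Fin d)) : ℝ≥0∞ :=
  (∫⁻ θ in {θ : ℝ | α < (θ : EReal) ∧ (θ : EReal) < β},
      (maxX d (fun y => ‖f t y θ‖^2) x) ^ (1/(2*H))) ^ (2*H)

/-- The cube `Q₀ = [-4,0] × [-1,1]^d ⊆ ℝ^{d+1}`. -/
def cubeQ0 (d : ℕ) : Set (ℝ × EuclideanSpace ℝ (Fin d)) :=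
  Set.Icc (-4 : ℝ) 0 ×ˢ {x | ∀ j, x j ∈ Set.Icc (-1 : ℝ) 1}

section KernelFacts

variable {d : ℕ}

lemma heatKernel_pos {t : ℝ} (ht : 0 < t) (x : EuclideanSpace ℝ (Fin d)) :
    0 < heatKernel d t x := by
  unfold heatKernel
  have := Real.pi_pos
  positivity

lemma continuous_heatKernel (t : ℝ) : Continuous (heatKernel d t) := by
  unfold heatKernel
  fun_prop

lemma heatKernel_neg (t : ℝ) (x : EuclideanSpace ℝ (Fin d)) :
    heatKernel d t (-x) = heatKernel d t x := by
  simp [heatKernel]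

lemma measurable_heatKernel_uncurry :
    Measurable fun q : ℝ × EuclideanSpace ℝ (Fin d) => heatKernel d q.1 q.2 := by
  unfold heatKernel
  fun_prop

lemma integral_heatKernel {t : ℝ} (ht : 0 < t) : ∫ x, heatKernel d t x = 1 := by
  unfold heatKernel
  have h := GaussianFourier.integral_rexp_neg_mul_sq_norm (V := EuclideanSpace ℝ (Fin d))
    (b := 1 / (4 * t)) (by positivity)
  have e : ∀ x : EuclideanSpace ℝ (Fin d), -‖x‖ ^ 2 / (4 * t) = -(1 / (4 * t)) * ‖x‖ ^ 2 := by
    intro x; ring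
  simp_rw [e]
  rw [integral_const_mul, h, finrank_euclideanSpace_fin]
  have hp := Real.pi_pos
  have : Real.pi / (1 / (4 * t)) = 4 * Real.pi * t := by field_simp
  rw [this, ← Real.rpow_add (by positivity)]
  have : -(d : ℝ) / 2 + d / 2 = 0 := by ring
  rw [this, Real.rpow_zero]

lemma integrable_heatKernel {t : ℝ} (ht : 0 < t) : Integrable (heatKernel d t) :=
  .of_integral_ne_zero (by rw [integral_heatKernel ht]; exact one_ne_zero)

lemma lintegral_heatKernel {t : ℝ} (ht : 0 < t) :
    ∫⁻ x, ENNReal.ofReal (heatKernel d t x) = 1 := by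
  rw [← ofReal_integral_eq_lintegral_ofReal (integrable_heatKernel ht)
    (.of_forall fun x => (heatKernel_pos ht x).le), integral_heatKernel ht, ENNReal.ofReal_one]

lemma heatKernel_mul_heatKernel {a b : ℝ} (ha : 0 < a) (hb : 0 < b)
    (x y z : EuclideanSpace ℝ (Fin d)) :
    heatKernel d a (x - y) * heatKernel d b (y - z) =
      heatKernel d (a + b) (x - z) *
        heatKernel d (a * b / (a + b)) (y - (z + (b / (a + b)) • (x - z))) := by
  have hp := Real.pi_pos
  have hab : 0 < a + b := by positivity
  obtain ⟨p, rfl⟩ : ∃ p, x = p + z := ⟨x - z, by abel⟩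
  obtain ⟨q, rfl⟩ : ∃ q, y = q + z := ⟨y - z, by abel⟩
  have e1 : p + z - (q + z) = p - q := by abel
  have e2 : q + z - (z + (b / (a + b)) • (p + z - z)) = q - (b / (a + b)) • p := by
    rw [add_sub_cancel_right]; abel
  rw [e1, e2, add_sub_cancel_right, add_sub_cancel_right]
  unfold heatKernel
  rw [mul_mul_mul_comm, mul_mul_mul_comm ((4 * Real.pi * (a + b)) ^ (-(d : ℝ) / 2)),
    ← Real.mul_rpow (by positivity) (by positivity), ← Real.mul_rpow (by positivity) (by positivity),
    ← Real.exp_add, ← Real.exp_add]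
  congr 2
  · field_simp
  · rw [norm_sub_sq_real, norm_sub_sq_real, norm_smul, inner_smul_right,
      real_inner_comm p q, Real.norm_of_nonneg (by positivity)]
    field_simp
    ring

lemma integral_heatKernel_mul_heatKernel {a b : ℝ} (ha : 0 < a) (hb : 0 < b)
    (x z : EuclideanSpace ℝ (Fin d)) :
    ∫ y, heatKernel d a (x - y) * heatKernel d b (y - z) = heatKernel d (a + b) (x - z) := by
  simp_rw [heatKernel_mul_heatKernel ha hb]
  rw [integral_const_mul, integral_sub_right_eq_self (heatKernel d (a * b / (a + b))),
    integral_heatKernel (by positivity), mul_one]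

lemma lintegral_heatKernel_mul_heatKernel {a b : ℝ} (ha : 0 < a) (hb : 0 < b)
    (x z : EuclideanSpace ℝ (Fin d)) :
    ∫⁻ y, ENNReal.ofReal (heatKernel d a (x - y)) * ENNReal.ofReal (heatKernel d b (y - z)) =
      ENNReal.ofReal (heatKernel d (a + b) (x - z)) := by
  simp_rw [← ENNReal.ofReal_mul (heatKernel_pos ha _).le, heatKernel_mul_heatKernel ha hb,
    ENNReal.ofReal_mul (heatKernel_pos (add_pos ha hb) _).le]
  rw [lintegral_const_mul' _ _ ENNReal.ofReal_ne_top,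
    lintegral_sub_right_eq_self fun y => ENNReal.ofReal (heatKernel d (a * b / (a + b)) y),
    lintegral_heatKernel (by positivity), mul_one]

lemma heatKernel_factor_two_mul (d : ℕ) {t : ℝ} (ht : 0 < t) :
    (4 * Real.pi * t) ^ (-(d : ℝ) / 2) =
      2 ^ ((d : ℝ) / 2) * (4 * Real.pi * (2 * t)) ^ (-(d : ℝ) / 2) := by
  have hp := Real.pi_pos
  rw [show 4 * Real.pi * (2 * t) = 2 * (4 * Real.pi * t) by ring,
    Real.mul_rpow (x := 2) (by positivity) (by positivity), ← mul_assoc,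
    ← Real.rpow_add (by positivity), show (d : ℝ) / 2 + -(d : ℝ) / 2 = 0 by ring,
    Real.rpow_zero, one_mul]

/-- Dilating time by the factor `2` absorbs a quadratic weight. -/
lemma norm_sq_mul_heatKernel_le {t : ℝ} (ht : 0 < t) (w : EuclideanSpace ℝ (Fin d)) :
    ‖w‖ ^ 2 * heatKernel d t w ≤ (8 * 2 ^ ((d : ℝ) / 2)) * t * heatKernel d (2 * t) w := by
  have hp := Real.pi_pos
  unfold heatKernel
  have h1 := heatKernel_factor_two_mul d ht
  have h2 : Real.exp (-‖w‖ ^ 2 / (4 * t)) =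
      Real.exp (-‖w‖ ^ 2 / (4 * (2 * t))) * Real.exp (-(‖w‖ ^ 2 / (8 * t))) := by
    rw [← Real.exp_add]; congr 1; field_simp; ring
  have h3 : ‖w‖ ^ 2 / (8 * t) * Real.exp (-(‖w‖ ^ 2 / (8 * t))) ≤ 1 := by
    rw [Real.exp_neg, ← div_eq_mul_inv, div_le_one (Real.exp_pos _)]
    linarith [Real.add_one_le_exp (‖w‖ ^ 2 / (8 * t))]
  have h4 : ‖w‖ ^ 2 * Real.exp (-(‖w‖ ^ 2 / (8 * t))) ≤ 8 * t := by
    have := mul_le_mul_of_nonneg_left h3 (by positivity : 0 ≤ 8 * t)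
    rwa [mul_one, ← mul_assoc, mul_div_cancel₀ _ (by positivity)] at this
  rw [h1, h2]
  set A := (4 * Real.pi * (2 * t)) ^ (-(d : ℝ) / 2)
  set B := Real.exp (-‖w‖ ^ 2 / (4 * (2 * t)))
  have hA : 0 ≤ A := by positivity
  have hB : 0 ≤ B := by positivity
  calc ‖w‖ ^ 2 * (2 ^ ((d : ℝ) / 2) * A * (B * Real.exp (-(‖w‖ ^ 2 / (8 * t)))))
      = 2 ^ ((d : ℝ) / 2) * A * B * (‖w‖ ^ 2 * Real.exp (-(‖w‖ ^ 2 / (8 * t)))) := by ring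
    _ ≤ 2 ^ ((d : ℝ) / 2) * A * B * (8 * t) := by gcongr
    _ = _ := by ring

lemma heatKernel_le_two_mul {t : ℝ} (ht : 0 < t) (w : EuclideanSpace ℝ (Fin d)) :
    heatKernel d t w ≤ 2 ^ ((d : ℝ) / 2) * heatKernel d (2 * t) w := by
  have hp := Real.pi_pos
  unfold heatKernel
  have h1 := heatKernel_factor_two_mul d ht
  rw [h1, mul_assoc]
  have : -‖w‖ ^ 2 / (4 * t) ≤ -‖w‖ ^ 2 / (4 * (2 * t)) := by
    rw [neg_div, neg_div, neg_le_neg_iff]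
    gcongr
    linarith
  gcongr

/-- Dilating time by the factor `2` absorbs a unit translation. -/
lemma heatKernel_translate_le {t : ℝ} (ht : 0 < t) :
    ∃ C, 0 ≤ C ∧ ∀ w w' : EuclideanSpace ℝ (Fin d), ‖w - w'‖ ≤ 1 →
      heatKernel d t w ≤ C * heatKernel d (2 * t) w' := by
  have hp := Real.pi_pos
  refine ⟨2 ^ ((d : ℝ) / 2) * Real.exp (1 / (4 * t)), by positivity, fun w w' h => ?_⟩
  unfold heatKernel
  have h1 := heatKernel_factor_two_mul d ht
  have h2 : ‖w'‖ ^ 2 ≤ 2 * ‖w‖ ^ 2 + 2 := by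
    have : ‖w'‖ ≤ ‖w‖ + 1 := by
      have := norm_sub_norm_le w' w
      rw [norm_sub_rev] at this
      linarith
    nlinarith [norm_nonneg w', norm_nonneg w, sq_nonneg (‖w‖ - 1)]
  have h3 : -‖w‖ ^ 2 / (4 * t) ≤ 1 / (4 * t) + -‖w'‖ ^ 2 / (4 * (2 * t)) := by
    have : 1 / (4 * t) + -‖w'‖ ^ 2 / (4 * (2 * t)) - -‖w‖ ^ 2 / (4 * t) =
        (2 * ‖w‖ ^ 2 + 2 - ‖w'‖ ^ 2) / (8 * t) := by field_simp; ring
    have : 0 ≤ (2 * ‖w‖ ^ 2 + 2 - ‖w'‖ ^ 2) / (8 * t) := div_nonneg (by linarith) (by positivity)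
    linarith
  calc (4 * Real.pi * t) ^ (-(d : ℝ) / 2) * Real.exp (-‖w‖ ^ 2 / (4 * t))
      ≤ (4 * Real.pi * t) ^ (-(d : ℝ) / 2) *
        Real.exp (1 / (4 * t) + -‖w'‖ ^ 2 / (4 * (2 * t))) := by gcongr
    _ = _ := by rw [h1, Real.exp_add]; ring

lemma hasFDerivAt_heatKernel (t : ℝ) (w : EuclideanSpace ℝ (Fin d)) :
    HasFDerivAt (heatKernel d t) ((-(heatKernel d t w / (2 * t))) • innerSL ℝ w) w := by
  unfold heatKernel
  have h := (((hasStrictFDerivAt_norm_sq w).hasFDerivAt.neg.mul_const (4 * t)⁻¹).exp.const_mul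
    ((4 * Real.pi * t) ^ (-(d : ℝ) / 2)))
  convert! h using 1
  ext v
  simp
  by_cases ht : t = 0
  · simp [ht]
  · field_simp
    ring

lemma norm_mul_heatKernel_le {t : ℝ} (ht : 0 < t) :
    ∃ C, 0 ≤ C ∧ ∀ w : EuclideanSpace ℝ (Fin d),
      heatKernel d t w * ‖w‖ ≤ C * heatKernel d (2 * t) w := by
  refine ⟨(8 * 2 ^ ((d : ℝ) / 2)) * t + 2 ^ ((d : ℝ) / 2), by positivity, fun w => ?_⟩
  have h1 := norm_sq_mul_heatKernel_le ht w
  have h2 := heatKernel_le_two_mul ht w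
  have h3 := heatKernel_pos ht w
  have : ‖w‖ ≤ ‖w‖ ^ 2 + 1 := by nlinarith [sq_nonneg (‖w‖ - 1), norm_nonneg w]
  nlinarith [mul_le_mul_of_nonneg_left this h3.le]

end KernelFacts

section HeatOperator

variable {d : ℕ} {V : Type*} [NormedAddCommGroup V] [InnerProductSpace ℝ V]

lemma integrable_heatKernel_smul {t M : ℝ} (ht : 0 < t) {k : EuclideanSpace ℝ (Fin d) → V}
    (hk : AEStronglyMeasurable k) (hM : ∀ y, ‖k y‖ ≤ M) :
    Integrable fun w => heatKernel d t w • k w := by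
  refine ((integrable_heatKernel ht).mul_const M).mono'
    ((continuous_heatKernel t).aestronglyMeasurable.smul hk) (.of_forall fun w => ?_)
  rw [norm_smul, Real.norm_of_nonneg (heatKernel_pos ht w).le]
  exact mul_le_mul_of_nonneg_left (hM w) (heatKernel_pos ht w).le

lemma integrable_coord_sq_mul_heatKernel {t : ℝ} (ht : 0 < t) (j : Fin d) :
    Integrable fun w : EuclideanSpace ℝ (Fin d) => w j ^ 2 * heatKernel d t w := by
  refine ((integrable_heatKernel (d := d) (t := 2 * t) (by positivity)).const_mul
    ((8 * 2 ^ ((d : ℝ) / 2)) * t)).mono' ?_ (.of_forall fun w => ?_)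
  · have := continuous_heatKernel (d := d) t
    exact Continuous.aestronglyMeasurable (by fun_prop)
  · have h := heatKernel_pos ht w
    rw [Real.norm_of_nonneg (by positivity)]
    refine le_trans ?_ (norm_sq_mul_heatKernel_le ht w)
    gcongr ?_ * _
    rw [sq_le_sq, abs_norm]
    exact PiLp.norm_apply_le w j

lemma integral_coord_sq_mul_heatKernel_le {t : ℝ} (ht : 0 < t) (j : Fin d) :
    ∫ w : EuclideanSpace ℝ (Fin d), w j ^ 2 * heatKernel d t w ≤ (8 * 2 ^ ((d : ℝ) / 2)) * t := by
  calc ∫ w : EuclideanSpace ℝ (Fin d), w j ^ 2 * heatKernel d t w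
      ≤ ∫ w : EuclideanSpace ℝ (Fin d), (8 * 2 ^ ((d : ℝ) / 2)) * t * heatKernel d (2 * t) w := by
        refine integral_mono (integrable_coord_sq_mul_heatKernel ht j)
          ((integrable_heatKernel (by positivity)).const_mul _) fun w => ?_
        refine le_trans ?_ (norm_sq_mul_heatKernel_le ht w)
        have h := heatKernel_pos ht w
        dsimp only
        gcongr ?_ * _
        rw [sq_le_sq, abs_norm]
        exact PiLp.norm_apply_le w j
    _ = _ := by rw [integral_const_mul, integral_heatKernel (by positivity), mul_one]

lemma integrable_coord_mul_heatKernel {t : ℝ} (ht : 0 < t) (j : Fin d) :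
    Integrable fun w : EuclideanSpace ℝ (Fin d) => w j * heatKernel d t w := by
  refine ((integrable_heatKernel ht).add (integrable_coord_sq_mul_heatKernel ht j)).mono' ?_
    (.of_forall fun w => ?_)
  · have := continuous_heatKernel (d := d) t
    exact Continuous.aestronglyMeasurable (by fun_prop)
  · have h := heatKernel_pos ht w
    rw [norm_mul, Real.norm_of_nonneg h.le, Real.norm_eq_abs]
    have : |w j| ≤ 1 + w j ^ 2 := by
      rw [← sq_abs]; nlinarith [sq_nonneg (|w j| - 1), abs_nonneg (w j)]
    simp only [Pi.add_apply]
    nlinarith [mul_le_mul_of_nonneg_right this h.le]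

lemma integral_coord_mul_heatKernel (t : ℝ) (j : Fin d) :
    ∫ w : EuclideanSpace ℝ (Fin d), w j * heatKernel d t w = 0 := by
  have h := integral_neg_eq_self (fun w : EuclideanSpace ℝ (Fin d) => w j * heatKernel d t w) volume
  simp only [heatKernel_neg, PiLp.neg_apply, neg_mul, integral_neg] at h
  linarith

lemma integrable_coord_mul_heatKernel_smul {t M : ℝ} (ht : 0 < t) (j : Fin d)
    {k : EuclideanSpace ℝ (Fin d) → V} (hk : AEStronglyMeasurable k) (hM : ∀ y, ‖k y‖ ≤ M) :
    Integrable fun w => (w j * heatKernel d t w) • k w := by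
  refine ((integrable_coord_mul_heatKernel ht j).norm.mul_const M).mono'
    ((integrable_coord_mul_heatKernel ht j).aestronglyMeasurable.smul hk) (.of_forall fun w => ?_)
  rw [norm_smul]
  exact mul_le_mul_of_nonneg_left (hM w) (norm_nonneg _)

variable [CompleteSpace V]

/-- Bessel's inequality in `L²` of the heat kernel measure, for the orthogonal functions
`1` and `w ↦ w j`. -/
lemma heatKernel_bessel {t M : ℝ} (ht : 0 < t) (j : Fin d)
    {k : EuclideanSpace ℝ (Fin d) → V} (hk : AEStronglyMeasurable k) (hM : ∀ y, ‖k y‖ ≤ M) :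
    ‖∫ w, heatKernel d t w • k w‖ ^ 2 +
        ‖∫ w, (w j * heatKernel d t w) • k w‖ ^ 2 / ((8 * 2 ^ ((d : ℝ) / 2)) * t) ≤
      ∫ w, heatKernel d t w * ‖k w‖ ^ 2 := by
  set a := ∫ w, heatKernel d t w • k w with ha
  set b := ∫ w, (w j * heatKernel d t w) • k w with hb
  set κ := (8 * 2 ^ ((d : ℝ) / 2)) * t with hκ
  have hκ0 : 0 < κ := by positivity
  have i1 : Integrable fun w => heatKernel d t w * ‖k w‖ ^ 2 := by
    simp only [← smul_eq_mul]
    refine integrable_heatKernel_smul (M := M ^ 2) ht (hk.norm.pow 2) fun y => ?_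
    rw [Real.norm_of_nonneg (by positivity)]
    gcongr
    exact hM y
  have i2 := (integrable_heatKernel (d := d) ht).const_mul (‖a‖ ^ 2)
  have i3 := (integrable_coord_sq_mul_heatKernel (d := d) ht j).const_mul (κ⁻¹ ^ 2 * ‖b‖ ^ 2)
  have i4 := (integrable_coord_mul_heatKernel (d := d) ht j).const_mul (2 * κ⁻¹ * inner ℝ a b)
  have i5 := ((integrable_heatKernel_smul ht hk hM).const_inner (𝕜 := ℝ) a).const_mul 2
  have i6 := ((integrable_coord_mul_heatKernel_smul ht j hk hM).const_inner (𝕜 := ℝ) b).const_mul (2 * κ⁻¹)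
  have key : 0 ≤ ∫ w, (heatKernel d t w * ‖k w‖ ^ 2 + ‖a‖ ^ 2 * heatKernel d t w
      + κ⁻¹ ^ 2 * ‖b‖ ^ 2 * (w j ^ 2 * heatKernel d t w)
      + 2 * κ⁻¹ * inner ℝ a b * (w j * heatKernel d t w)
      - 2 * inner ℝ a (heatKernel d t w • k w)
      - 2 * κ⁻¹ * inner ℝ b ((w j * heatKernel d t w) • k w)) := by
    refine integral_nonneg fun w => ?_
    have h := heatKernel_pos ht w
    have : 0 ≤ heatKernel d t w * ‖k w - (a + (κ⁻¹ * w j) • b)‖ ^ 2 := by positivity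
    refine this.trans_eq ?_
    rw [norm_sub_sq_real, norm_add_sq_real, inner_add_right, norm_smul, inner_smul_right,
      inner_smul_right, inner_smul_right, inner_smul_right, real_inner_comm a, real_inner_comm b,
      mul_pow, Real.norm_eq_abs, sq_abs]
    ring
  have s2 := i1.add i2
  have s3 := s2.add i3
  have s4 := s3.add i4
  have s5 := s4.sub i5
  simp only [Pi.add_def, Pi.sub_def] at s2 s3 s4 s5
  rw [integral_sub s5 i6, integral_sub s4 i5, integral_add s3 i4, integral_add s2 i3,
    integral_add i1 i2,
    integral_const_mul, integral_const_mul, integral_const_mul, integral_const_mul,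
    integral_const_mul, integral_heatKernel ht, integral_coord_mul_heatKernel,
    integral_inner (integrable_heatKernel_smul ht hk hM),
    integral_inner (integrable_coord_mul_heatKernel_smul ht j hk hM), ← ha, ← hb,
    real_inner_self_eq_norm_sq, real_inner_self_eq_norm_sq] at key
  have h2 : κ⁻¹ ^ 2 * ‖b‖ ^ 2 * ∫ w : EuclideanSpace ℝ (Fin d), w j ^ 2 * heatKernel d t w ≤
      ‖b‖ ^ 2 / κ := by
    calc _ ≤ κ⁻¹ ^ 2 * ‖b‖ ^ 2 * κ := by
          gcongr
          exact integral_coord_sq_mul_heatKernel_le ht j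
      _ = _ := by field_simp
  have h3 : 2 * κ⁻¹ * ‖b‖ ^ 2 = 2 * (‖b‖ ^ 2 / κ) := by ring
  linarith

lemma heatOp_eq_integral (t : ℝ) (k : EuclideanSpace ℝ (Fin d) → V)
    (x : EuclideanSpace ℝ (Fin d)) :
    heatOp d t k x = ∫ y, heatKernel d t (x - y) • k y := by
  unfold heatOp
  rw [← integral_sub_left_eq_self (fun y => heatKernel d t y • k (x - y)) volume x]
  simp

/-- The `j`-th spatial derivative of the heat kernel. -/
noncomputable def heatKernelDeriv (d : ℕ) (j : Fin d) (t : ℝ) (w : EuclideanSpace ℝ (Fin d)) : ℝ :=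
  -(2 * t)⁻¹ * (w j * heatKernel d t w)

lemma hasFDerivAt_heatOp {t M : ℝ} (ht : 0 < t) {k : EuclideanSpace ℝ (Fin d) → V}
    (hk : StronglyMeasurable k) (hM : ∀ y, ‖k y‖ ≤ M) (x : EuclideanSpace ℝ (Fin d)) :
    Integrable (fun y => ((-(heatKernel d t (x - y) / (2 * t))) • innerSL ℝ (x - y)).smulRight (k y))
      ∧ HasFDerivAt (heatOp d t k)
      (∫ y, ((-(heatKernel d t (x - y) / (2 * t))) • innerSL ℝ (x - y)).smulRight (k y)) x := by
  obtain ⟨C, hC, hC'⟩ := norm_mul_heatKernel_le (d := d) ht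
  obtain ⟨D, hD, hD'⟩ := heatKernel_translate_le (d := d) (t := 2 * t) (by positivity)
  have hM0 : 0 ≤ M := (norm_nonneg _).trans (hM 0)
  have e : heatOp d t k = fun x => ∫ y, heatKernel d t (x - y) • k y :=
    funext (heatOp_eq_integral t k)
  have cK := continuous_heatKernel (d := d) t
  have hmeas : ∀ x : EuclideanSpace ℝ (Fin d), AEStronglyMeasurable (fun y =>
      ((-(heatKernel d t (x - y) / (2 * t))) • innerSL ℝ (x - y)).smulRight (k y)) := by
    intro x
    have h1 : Continuous fun y : EuclideanSpace ℝ (Fin d) =>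
      (-(heatKernel d t (x - y) / (2 * t))) • innerSL ℝ (x - y) := by fun_prop
    exact ((ContinuousLinearMap.smulRightL ℝ (EuclideanSpace ℝ (Fin d)) V).continuous₂.comp_stronglyMeasurable
      (h1.stronglyMeasurable.prodMk hk)).aestronglyMeasurable
  have hbound : ∀ y, ∀ x' ∈ Metric.ball x 1,
      ‖((-(heatKernel d t (x' - y) / (2 * t))) • innerSL ℝ (x' - y)).smulRight (k y)‖ ≤
        (2 * t)⁻¹ * C * D * M * heatKernel d (2 * (2 * t)) (x - y) := by
    intro y x' hx'
    have h := heatKernel_pos ht (x' - y)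
    rw [ContinuousLinearMap.norm_smulRight_apply, norm_smul, innerSL_apply_norm, norm_neg,
      Real.norm_of_nonneg (by positivity)]
    have h1 := hC' (x' - y)
    have h2 := hD' (x' - y) (x - y) (by
      rw [sub_sub_sub_cancel_right, ← dist_eq_norm]; exact (Metric.mem_ball.1 hx').le)
    calc heatKernel d t (x' - y) / (2 * t) * ‖x' - y‖ * ‖k y‖
        = (2 * t)⁻¹ * (heatKernel d t (x' - y) * ‖x' - y‖) * ‖k y‖ := by ring
      _ ≤ (2 * t)⁻¹ * (C * (D * heatKernel d (2 * (2 * t)) (x - y))) * M := by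
          have h3 : 0 < heatKernel d (2 * (2 * t)) (x - y) := heatKernel_pos (by positivity) _
          have h4 := hM y
          have h5 := h1.trans (mul_le_mul_of_nonneg_left h2 hC)
          gcongr
      _ = _ := by ring
  have hbi : Integrable fun y => (2 * t)⁻¹ * C * D * M * heatKernel d (2 * (2 * t)) (x - y) :=
    ((integrable_heatKernel (by positivity)).comp_sub_left x).const_mul _
  refine ⟨hbi.mono' (hmeas x) (.of_forall fun y => hbound y x (Metric.mem_ball_self one_pos)), ?_⟩
  rw [e]
  refine hasFDerivAt_integral_of_dominated_of_fderiv_le (Metric.ball_mem_nhds x one_pos)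
    (.of_forall fun x' => ?_) ?_ (hmeas x) (.of_forall hbound) hbi
    (.of_forall fun y x' _ => ?_)
  · exact ((cK.comp (continuous_sub_left x')).stronglyMeasurable.smul hk).aestronglyMeasurable
  · have := (integrable_heatKernel_smul (k := fun w => k (x - w)) ht
      (hk.comp_measurable (measurable_const.sub measurable_id)).aestronglyMeasurable
      fun w => hM _).comp_sub_left x
    simpa using this
  · have := (hasFDerivAt_heatKernel t (x' - y)).comp x' ((hasFDerivAt_id x').sub_const y)
    exact HasFDerivAt.smul_const this (k y)

lemma fderiv_heatOp_single {t M : ℝ} (ht : 0 < t) {k : EuclideanSpace ℝ (Fin d) → V}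
    (hk : StronglyMeasurable k) (hM : ∀ y, ‖k y‖ ≤ M) (x : EuclideanSpace ℝ (Fin d)) (j : Fin d) :
    fderiv ℝ (heatOp d t k) x (EuclideanSpace.single j 1) =
      ∫ y, heatKernelDeriv d j t (x - y) • k y := by
  obtain ⟨h1, h2⟩ := hasFDerivAt_heatOp ht hk hM x
  rw [h2.fderiv, ContinuousLinearMap.integral_apply h1]
  refine integral_congr_ae (.of_forall fun y => ?_)
  simp only [ContinuousLinearMap.smulRight_apply, _root_.smul_apply, innerSL_apply_apply,
    EuclideanSpace.inner_single_right, heatKernelDeriv]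
  congr 1
  simp
  ring

/-- A reverse local Poincaré inequality for the heat semigroup. -/
lemma heatOp_reverse_poincare {t M : ℝ} (ht : 0 < t) (j : Fin d)
    {k : EuclideanSpace ℝ (Fin d) → V} (hk : StronglyMeasurable k) (hM : ∀ y, ‖k y‖ ≤ M)
    (x : EuclideanSpace ℝ (Fin d)) :
    ‖heatOp d t k x‖ ^ 2 +
        t / (2 * 2 ^ ((d : ℝ) / 2)) * ‖fderiv ℝ (heatOp d t k) x (EuclideanSpace.single j 1)‖ ^ 2 ≤
      ∫ y, heatKernel d t (x - y) * ‖k y‖ ^ 2 := by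
  have h := heatKernel_bessel (k := fun w => k (x - w)) ht j
      (hk.comp_measurable (measurable_const.sub measurable_id)).aestronglyMeasurable fun w => hM _
  rw [fderiv_heatOp_single ht hk hM,
    ← integral_sub_left_eq_self (fun y => heatKernelDeriv d j t (x - y) • k y) volume x,
    ← integral_sub_left_eq_self (fun y => heatKernel d t (x - y) * ‖k y‖ ^ 2) volume x]
  simp only [_root_.sub_sub_cancel]
  refine le_trans (le_of_eq ?_) h
  unfold heatOp heatKernelDeriv
  congr 1
  simp only [mul_smul (-(2 * t)⁻¹)]
  rw [integral_smul, norm_smul, mul_pow, norm_neg, norm_inv, Real.norm_of_nonneg (by positivity)]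
  field_simp
  ring

end HeatOperator

section Energy

variable {d : ℕ}

/-- The heat semigroup acting on functions with values in `[0, ∞]`. -/
noncomputable def heatLInt (d : ℕ) (t : ℝ) (φ : EuclideanSpace ℝ (Fin d) → ℝ≥0∞)
    (x : EuclideanSpace ℝ (Fin d)) : ℝ≥0∞ :=
  ∫⁻ y, ENNReal.ofReal (heatKernel d t (x - y)) * φ y

lemma measurable_ofReal_heatKernel_sub (t : ℝ) :
    Measurable fun q : EuclideanSpace ℝ (Fin d) × EuclideanSpace ℝ (Fin d) =>
      ENNReal.ofReal (heatKernel d t (q.1 - q.2)) :=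
  ((continuous_heatKernel t).measurable.comp (measurable_fst.sub measurable_snd)).ennreal_ofReal

lemma heatLInt_heatLInt {a b : ℝ} (ha : 0 < a) (hb : 0 < b)
    {φ : EuclideanSpace ℝ (Fin d) → ℝ≥0∞} (hφ : Measurable φ) (x : EuclideanSpace ℝ (Fin d)) :
    heatLInt d a (heatLInt d b φ) x = heatLInt d (a + b) φ x := by
  have m := measurable_ofReal_heatKernel_sub (d := d)
  have mK : ∀ t, Measurable (heatKernel d t) := fun t => (continuous_heatKernel t).measurable
  unfold heatLInt
  calc ∫⁻ y, ENNReal.ofReal (heatKernel d a (x - y)) *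
        ∫⁻ z, ENNReal.ofReal (heatKernel d b (y - z)) * φ z
      = ∫⁻ y, ∫⁻ z, ENNReal.ofReal (heatKernel d a (x - y)) *
        (ENNReal.ofReal (heatKernel d b (y - z)) * φ z) := by
        refine lintegral_congr fun y => ?_
        rw [lintegral_const_mul' _ _ ENNReal.ofReal_ne_top]
    _ = ∫⁻ z, ∫⁻ y, ENNReal.ofReal (heatKernel d a (x - y)) *
        (ENNReal.ofReal (heatKernel d b (y - z)) * φ z) := by
        refine lintegral_lintegral_swap (Measurable.aemeasurable ?_)
        have h1 : Measurable fun q : EuclideanSpace ℝ (Fin d) × EuclideanSpace ℝ (Fin d) =>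
            ENNReal.ofReal (heatKernel d a (x - q.1)) :=
          (mK a |>.comp (measurable_const.sub measurable_fst)).ennreal_ofReal
        have h2 : Measurable fun q : EuclideanSpace ℝ (Fin d) × EuclideanSpace ℝ (Fin d) =>
            φ q.2 := hφ.comp measurable_snd
        simp only [Function.uncurry_def]
        exact h1.mul ((m b).mul h2)
    _ = _ := by
        refine lintegral_congr fun z => ?_
        simp_rw [← mul_assoc]
        rw [lintegral_mul_const, lintegral_heatKernel_mul_heatKernel ha hb]
        have h1 : Measurable fun y => ENNReal.ofReal (heatKernel d a (x - y)) :=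
          (mK a |>.comp (measurable_const.sub measurable_id)).ennreal_ofReal
        have h2 : Measurable fun y => ENNReal.ofReal (heatKernel d b (y - z)) :=
          (mK b |>.comp (measurable_id.sub measurable_const)).ennreal_ofReal
        exact h1.mul h2

lemma heatLInt_mono {t : ℝ} {φ ψ : EuclideanSpace ℝ (Fin d) → ℝ≥0∞} (h : ∀ y, φ y ≤ ψ y)
    (x : EuclideanSpace ℝ (Fin d)) : heatLInt d t φ x ≤ heatLInt d t ψ x :=
  lintegral_mono fun y => by gcongr; exact h y

lemma heatLInt_const {t : ℝ} (ht : 0 < t) {c : ℝ≥0∞} (hc : c ≠ ⊤)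
    (x : EuclideanSpace ℝ (Fin d)) : heatLInt d t (fun _ => c) x = c := by
  unfold heatLInt
  rw [lintegral_mul_const' _ _ hc,
    lintegral_sub_left_eq_self fun y => ENNReal.ofReal (heatKernel d t y),
    lintegral_heatKernel ht, one_mul]

/-- The superlevel sets of the heat kernel are balls. -/
lemma heatKernel_superlevel {t c : ℝ} (ht : 0 < t) (hc : 0 < c) (x : EuclideanSpace ℝ (Fin d)) :
    {y | c < heatKernel d t (x - y)} = ∅ ∨
      ∃ r, 0 < r ∧ {y | c < heatKernel d t (x - y)} = Metric.ball x r := by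
  have hp := Real.pi_pos
  have hA : 0 < (4 * Real.pi * t) ^ (-(d : ℝ) / 2) := by positivity
  set A := (4 * Real.pi * t) ^ (-(d : ℝ) / 2) with hA'
  have key : ∀ y, c < heatKernel d t (x - y) ↔ ‖x - y‖ ^ 2 < -(4 * t) * Real.log (c / A) := by
    intro y
    unfold heatKernel
    rw [← hA', ← div_lt_iff₀' hA, ← Real.log_lt_iff_lt_exp (by positivity),
      lt_div_iff₀ (by positivity)]
    constructor <;> intro h <;> linarith
  rcases le_or_gt (-(4 * t) * Real.log (c / A)) 0 with h | h
  · left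
    ext y
    simp only [Set.mem_ofPred_eq, key, Set.mem_empty_iff_false, iff_false, not_lt]
    exact h.trans (by positivity)
  · right
    refine ⟨√(-(4 * t) * Real.log (c / A)), Real.sqrt_pos.2 h, ?_⟩
    ext y
    simp only [Set.mem_ofPred_eq, key, Metric.mem_ball, dist_eq_norm, norm_sub_rev y x]
    rw [Real.lt_sqrt (norm_nonneg _)]

lemma setLIntegral_ball_le_maxX (g : EuclideanSpace ℝ (Fin d) → ℝ) (x : EuclideanSpace ℝ (Fin d))
    {r : ℝ} (hr : 0 < r) :
    ∫⁻ y in Metric.ball x r, ENNReal.ofReal |g y| ≤ maxX d g x * volume (Metric.ball x r) := by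
  rw [← ENNReal.div_le_iff_le_mul (.inl (Metric.measure_ball_pos volume x hr).ne')
    (.inl measure_ball_lt_top.ne), ENNReal.div_eq_inv_mul]
  exact le_iSup₂ (f := fun (r : ℝ) (_ : 0 < r) =>
    (volume (Metric.ball x r))⁻¹ * ∫⁻ y in Metric.ball x r, ENNReal.ofReal |g y|) r hr

/-- The heat semigroup is dominated by the maximal function. -/
lemma heatLInt_le_maxX {t : ℝ} (ht : 0 < t) {g : EuclideanSpace ℝ (Fin d) → ℝ}
    (hg : Measurable g) (x : EuclideanSpace ℝ (Fin d)) :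
    heatLInt d t (fun y => ENNReal.ofReal |g y|) x ≤ maxX d g x := by
  rcases eq_or_ne (maxX d g x) ⊤ with htop | htop
  · rw [htop]; exact le_top
  have mK : Measurable fun y => heatKernel d t (x - y) :=
    (continuous_heatKernel t).measurable.comp (measurable_const.sub measurable_id)
  have mg : Measurable fun y => ENNReal.ofReal |g y| := hg.abs.ennreal_ofReal
  have e : heatLInt d t (fun y => ENNReal.ofReal |g y|) x =
      ∫⁻ y, ENNReal.ofReal (heatKernel d t (x - y))
        ∂(volume.withDensity fun y => ENNReal.ofReal |g y|) := by
    rw [lintegral_withDensity_eq_lintegral_mul _ mg mK.ennreal_ofReal]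
    exact lintegral_congr fun y => mul_comm _ _
  rw [e, lintegral_eq_lintegral_meas_lt _ (.of_forall fun y => (heatKernel_pos ht _).le)
    mK.aemeasurable]
  calc _ ≤ ∫⁻ c in Set.Ioi (0 : ℝ), maxX d g x * volume {y | c < heatKernel d t (x - y)} := by
        refine setLIntegral_mono' measurableSet_Ioi fun c hc => ?_
        rw [withDensity_apply _ (measurableSet_lt measurable_const mK)]
        rcases heatKernel_superlevel ht hc x with h | ⟨r, hr, h⟩
        · simp [h]
        · rw [h]
          exact setLIntegral_ball_le_maxX g x hr
    _ = maxX d g x * ∫⁻ y, ENNReal.ofReal (heatKernel d t (x - y)) := by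
        rw [lintegral_const_mul' _ _ htop, ← lintegral_eq_lintegral_meas_lt _
          (.of_forall fun y => (heatKernel_pos ht _).le) mK.aemeasurable]
    _ = maxX d g x := by
        rw [lintegral_sub_left_eq_self fun y => ENNReal.ofReal (heatKernel d t y),
          lintegral_heatKernel ht, mul_one]

/-- A bounded quantity dissipated at rate at least `c * D` bounds the integral of `c * D`. -/
lemma lintegral_le_of_dissipation {E D : ℝ → ℝ≥0∞} {c T : ℝ} {B : ℝ≥0∞} (hB : B ≠ ⊤)
    (hE : ∀ τ ∈ Set.Ioo 0 T, E τ ≤ B)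
    (hD : ∀ s τ, 0 < s → s < τ → τ < T → E τ + ENNReal.ofReal (c * s) * D τ ≤ E (τ - s))
    (hc : 0 < c) :
    ENNReal.ofReal c * ∫⁻ τ in Set.Ioo 0 T, D τ ≤ B := by
  have hanti : AntitoneOn E (Set.Ioo 0 T) := by
    intro a ha b hb hab
    rcases hab.eq_or_lt with rfl | hab
    · rfl
    · have := hD (b - a) b (sub_pos.2 hab) (sub_lt_self b ha.1) hb.2
      rw [_root_.sub_sub_cancel] at this
      exact le_self_add.trans this
  have step : ∀ s ∈ Set.Ioo 0 T, ENNReal.ofReal c * ∫⁻ τ in Set.Ioo s T, D τ ≤ B := by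
    intro s hs
    have hfin : ∫⁻ τ in Set.Ioo s T, E τ ≠ ⊤ := by
      refine ne_top_of_le_ne_top (b := B * volume (Set.Ioo s T)) ?_ ?_
      · exact ENNReal.mul_ne_top hB measure_Ioo_lt_top.ne
      · rw [← setLIntegral_const]
        exact setLIntegral_mono' measurableSet_Ioo fun τ hτ => hE τ ⟨hs.1.trans hτ.1, hτ.2⟩
    have h1 : ∫⁻ τ in Set.Ioo s T, (E τ + ENNReal.ofReal (c * s) * D τ) ≤
        ∫⁻ τ in Set.Ioo s T, E (τ - s) :=
      setLIntegral_mono' measurableSet_Ioo fun τ hτ => hD s τ hs.1 hτ.1 hτ.2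
    rw [lintegral_add_left' (aemeasurable_restrict_of_antitoneOn measurableSet_Ioo
      (hanti.mono fun τ hτ => ⟨hs.1.trans hτ.1, hτ.2⟩)),
      lintegral_const_mul' _ _ ENNReal.ofReal_ne_top] at h1
    have h2 : ∫⁻ τ in Set.Ioo s T, E (τ - s) = ∫⁻ τ in Set.Ioo 0 (T - s), E τ := by
      rw [← lintegral_indicator measurableSet_Ioo, ← lintegral_indicator measurableSet_Ioo,
        ← lintegral_sub_right_eq_self (fun τ => (Set.Ioo 0 (T - s)).indicator E τ) s]
      refine lintegral_congr fun τ => ?_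
      simp only [Set.indicator_apply, Set.mem_Ioo, sub_pos, sub_lt_sub_iff_right]
    have h3 : ∫⁻ τ in Set.Ioo 0 (T - s), E τ ≤
        B * ENNReal.ofReal s + ∫⁻ τ in Set.Ioo s T, E τ := by
      calc ∫⁻ τ in Set.Ioo 0 (T - s), E τ ≤ ∫⁻ τ in Set.Ioc 0 s ∪ Set.Ioo s T, E τ := by
            refine lintegral_mono_set fun τ hτ => ?_
            rcases le_or_gt τ s with h | h
            · exact .inl ⟨hτ.1, h⟩
            · exact .inr ⟨h, hτ.2.trans (sub_lt_self T hs.1)⟩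
        _ ≤ (∫⁻ τ in Set.Ioc 0 s, E τ) + ∫⁻ τ in Set.Ioo s T, E τ := lintegral_union_le _ _ _
        _ ≤ _ := by
            gcongr
            calc ∫⁻ τ in Set.Ioc 0 s, E τ ≤ ∫⁻ τ in Set.Ioc 0 s, B :=
                  setLIntegral_mono' measurableSet_Ioc fun τ hτ => hE τ ⟨hτ.1, hτ.2.trans_lt hs.2⟩
              _ = _ := by rw [setLIntegral_const, Real.volume_Ioc, sub_zero]
    have h4 := h1.trans (h2.le.trans h3)
    rw [add_comm (B * _), ENNReal.add_le_add_iff_left hfin, ENNReal.ofReal_mul hc.le, mul_right_comm,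
      ENNReal.mul_le_mul_iff_left (ENNReal.ofReal_pos.2 hs.1).ne' ENNReal.ofReal_ne_top] at h4
    exact h4
  rcases le_or_gt T 0 with hT | hT
  · simp [Set.Ioo_eq_empty_of_le hT]
  have hU : Set.Ioo 0 T = ⋃ n : ℕ, Set.Ioo (T / (n + 2)) T := by
    ext τ
    simp only [Set.mem_iUnion, Set.mem_Ioo]
    constructor
    · rintro ⟨h0, h1⟩
      obtain ⟨n, hn⟩ := exists_nat_gt (T / τ)
      refine ⟨n, ?_, h1⟩
      rw [div_lt_iff₀ h0] at hn
      rw [div_lt_iff₀ (by positivity)]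
      nlinarith
    · rintro ⟨n, h0, h1⟩
      exact ⟨lt_trans (by positivity) h0, h1⟩
  rw [hU, setLIntegral_iUnion_of_directed, ENNReal.mul_iSup]
  · refine iSup_le fun n => step _ ⟨by positivity, ?_⟩
    rw [div_lt_iff₀ (by positivity)]
    nlinarith [(Nat.cast_nonneg n : (0 : ℝ) ≤ n)]
  · refine directed_of_isDirected_le fun m n hmn => ?_
    refine Set.Ioo_subset_Ioo_left ?_
    gcongr

variable {V : Type*} [NormedAddCommGroup V] [InnerProductSpace ℝ V] [CompleteSpace V]

lemma norm_heatOp_le {t M : ℝ} (ht : 0 < t) {k : EuclideanSpace ℝ (Fin d) → V}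
    (hM : ∀ y, ‖k y‖ ≤ M) (x : EuclideanSpace ℝ (Fin d)) : ‖heatOp d t k x‖ ≤ M := by
  unfold heatOp
  calc _ ≤ ∫ y, heatKernel d t y * M := by
        refine norm_integral_le_of_norm_le ((integrable_heatKernel ht).mul_const M)
          (.of_forall fun y => ?_)
        rw [norm_smul, Real.norm_of_nonneg (heatKernel_pos ht y).le]
        exact mul_le_mul_of_nonneg_left (hM _) (heatKernel_pos ht y).le
    _ = M := by rw [integral_mul_const, integral_heatKernel ht, one_mul]

lemma stronglyMeasurable_heatOp {t M : ℝ} (ht : 0 < t) {k : EuclideanSpace ℝ (Fin d) → V}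
    (hk : StronglyMeasurable k) (hM : ∀ y, ‖k y‖ ≤ M) : StronglyMeasurable (heatOp d t k) :=
  Continuous.stronglyMeasurable <| continuous_iff_continuousAt.2 fun x =>
    (hasFDerivAt_heatOp ht hk hM x).2.continuousAt

lemma heatOp_heatOp {a b M : ℝ} (ha : 0 < a) (hb : 0 < b) {k : EuclideanSpace ℝ (Fin d) → V}
    (hk : StronglyMeasurable k) (hM : ∀ y, ‖k y‖ ≤ M) :
    heatOp d a (heatOp d b k) = heatOp d (a + b) k := by
  ext x
  have cK := continuous_heatKernel (d := d)
  have hi : Integrable (Function.uncurry fun y z : EuclideanSpace ℝ (Fin d) =>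
      (heatKernel d a (x - y) * heatKernel d b (y - z)) • k z) (volume.prod volume) := by
    have hf : Integrable (Function.uncurry fun y z : EuclideanSpace ℝ (Fin d) =>
        heatKernel d a (x - y) * heatKernel d b (y - z)) (volume.prod volume) := by
      rw [integrable_prod_iff]
      · refine ⟨.of_forall fun y => ?_, ?_⟩
        · exact ((integrable_heatKernel hb).comp_sub_left y).const_mul (heatKernel d a (x - y))
        · have : ∀ y, ∫ z, ‖heatKernel d a (x - y) * heatKernel d b (y - z)‖ =
              heatKernel d a (x - y) := by
            intro y
            simp_rw [Real.norm_of_nonneg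
              (mul_pos (heatKernel_pos ha (x - y)) (heatKernel_pos hb (y - _))).le]
            rw [integral_const_mul, integral_sub_left_eq_self (heatKernel d b) volume y,
              integral_heatKernel hb, mul_one]
          simp only [Function.uncurry_apply_pair, this]
          exact (integrable_heatKernel ha).comp_sub_left x
      · refine Continuous.aestronglyMeasurable ?_
        have h1 := cK a
        have h2 := cK b
        simp only [Function.uncurry_def]
        fun_prop
    refine (hf.norm.mul_const M).mono'
      (hf.aestronglyMeasurable.smul (hk.comp_measurable measurable_snd).aestronglyMeasurable)
      (.of_forall fun q => ?_)
    simp only [Function.uncurry_def]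
    rw [norm_smul]
    exact mul_le_mul_of_nonneg_left (hM _) (norm_nonneg _)
  simp_rw [heatOp_eq_integral, ← integral_smul, smul_smul]
  rw [integral_integral_swap hi]
  refine integral_congr_ae (.of_forall fun z => ?_)
  simp only
  rw [integral_smul_const, integral_heatKernel_mul_heatKernel ha hb]

lemma heatOp_reverse_poincare_enorm {t M : ℝ} (ht : 0 < t) (j : Fin d)
    {k : EuclideanSpace ℝ (Fin d) → V} (hk : StronglyMeasurable k) (hM : ∀ y, ‖k y‖ ≤ M)
    (x : EuclideanSpace ℝ (Fin d)) :
    ‖heatOp d t k x‖ₑ ^ 2 + ENNReal.ofReal (1 / (2 * 2 ^ ((d : ℝ) / 2)) * t) *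
        ‖fderiv ℝ (heatOp d t k) x (EuclideanSpace.single j 1)‖ₑ ^ 2 ≤
      heatLInt d t (fun y => ‖k y‖ₑ ^ 2) x := by
  have h := heatOp_reverse_poincare ht j hk hM x
  have hi : Integrable fun y => heatKernel d t (x - y) * ‖k y‖ ^ 2 := by
    have := (integrable_heatKernel_smul (k := fun w => ‖k (x - w)‖ ^ 2) (M := M ^ 2) ht
      (((hk.comp_measurable (measurable_const.sub measurable_id)).norm).pow 2).aestronglyMeasurable
      fun w => by
        rw [Real.norm_of_nonneg (by positivity)]
        gcongr
        exact hM _).comp_sub_left x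
    simpa using this
  have e : heatLInt d t (fun y => ‖k y‖ₑ ^ 2) x =
      ENNReal.ofReal (∫ y, heatKernel d t (x - y) * ‖k y‖ ^ 2) := by
    rw [ofReal_integral_eq_lintegral_ofReal hi
      (.of_forall fun y => mul_nonneg (heatKernel_pos ht _).le (by positivity))]
    refine lintegral_congr fun y => ?_
    rw [ENNReal.ofReal_mul (heatKernel_pos ht _).le, ENNReal.ofReal_pow (norm_nonneg _),
      ofReal_norm]
  rw [e, ← ofReal_norm, ← ofReal_norm, ← ENNReal.ofReal_pow (norm_nonneg _),
    ← ENNReal.ofReal_pow (norm_nonneg _), ← ENNReal.ofReal_mul (by positivity),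
    ← ENNReal.ofReal_add (by positivity) (by positivity)]
  refine ENNReal.ofReal_le_ofReal (le_trans (le_of_eq ?_) h)
  ring

/-- Integrated energy dissipation of the heat flow, weighted by the backward heat kernel. -/
lemma lintegral_heatLInt_fderiv_heatOp_le {T M : ℝ} (j : Fin d)
    {h : EuclideanSpace ℝ (Fin d) → V} (hh : StronglyMeasurable h) (hM : ∀ y, ‖h y‖ ≤ M)
    (x : EuclideanSpace ℝ (Fin d)) :
    ENNReal.ofReal (1 / (2 * 2 ^ ((d : ℝ) / 2))) * ∫⁻ τ in Set.Ioo 0 T, heatLInt d (T - τ)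
        (fun y => ‖fderiv ℝ (heatOp d τ h) y (EuclideanSpace.single j 1)‖ₑ ^ 2) x ≤
      heatLInt d T (fun y => ‖h y‖ₑ ^ 2) x := by
  rcases le_or_gt T 0 with hT | hT
  · simp [Set.Ioo_eq_empty_of_le hT]
  refine lintegral_le_of_dissipation
    (E := fun τ => heatLInt d (T - τ) (fun y => ‖heatOp d τ h y‖ₑ ^ 2) x) ?_ ?_ ?_ (by positivity)
  · have hb : heatLInt d T (fun y => ‖h y‖ₑ ^ 2) x ≤ ENNReal.ofReal M ^ 2 := by
      rw [← heatLInt_const (d := d) hT (c := ENNReal.ofReal M ^ 2) (by simp) x]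
      refine heatLInt_mono (fun y => ?_) x
      rw [← ofReal_norm]
      gcongr
      exact hM y
    exact ne_top_of_le_ne_top (by simp) hb
  · intro τ hτ
    have : heatLInt d T (fun y => ‖h y‖ₑ ^ 2) x =
        heatLInt d (T - τ) (heatLInt d τ fun y => ‖h y‖ₑ ^ 2) x := by
      rw [heatLInt_heatLInt (sub_pos.2 hτ.2) hτ.1 (hh.enorm.pow_const 2), sub_add_cancel]
    rw [this]
    exact heatLInt_mono
      (fun y => le_self_add.trans (heatOp_reverse_poincare_enorm hτ.1 j hh hM y)) x
  · intro s τ hs hsτ hτ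
    have hτs : 0 < τ - s := sub_pos.2 hsτ
    have hk := stronglyMeasurable_heatOp hτs hh hM
    have hkM := norm_heatOp_le hτs hM
    have e : heatOp d τ h = heatOp d s (heatOp d (τ - s) h) := by
      rw [heatOp_heatOp hs hτs hh hM, add_sub_cancel]
    have e2 : heatLInt d (T - (τ - s)) (fun y => ‖heatOp d (τ - s) h y‖ₑ ^ 2) x =
        heatLInt d (T - τ) (heatLInt d s fun y => ‖heatOp d (τ - s) h y‖ₑ ^ 2) x := by
      rw [heatLInt_heatLInt (sub_pos.2 hτ) hs (hk.enorm.pow_const 2)]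
      congr 1
      ring
    rw [e2]
    refine le_trans (le_of_eq ?_)
      (heatLInt_mono (fun y => heatOp_reverse_poincare_enorm hs j hk hkM y) x)
    rw [← e]
    unfold heatLInt
    rw [← lintegral_const_mul' _ _ ENNReal.ofReal_ne_top, ← lintegral_add_left]
    · refine lintegral_congr fun y => ?_
      ring
    · exact ((measurable_ofReal_heatKernel_sub _).comp
        (measurable_const.prodMk measurable_id)).mul
        ((stronglyMeasurable_heatOp (hs.trans hsτ) hh hM).enorm.pow_const 2)

end Energy

section Minkowski

/-- **Minkowski's integral inequality**. -/
lemma lintegral_minkowski {X Θ : Type*} [MeasurableSpace X] [MeasurableSpace Θ]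
    (μ : Measure X) [IsFiniteMeasure μ] (ν : Measure Θ) [SFinite ν] {p : ℝ} (hp : 1 < p)
    {a : X → Θ → ℝ≥0∞} (ha : Measurable (Function.uncurry a)) :
    ∫⁻ x, (∫⁻ θ, a x θ ∂ν) ^ p ∂μ ≤ (∫⁻ θ, (∫⁻ x, a x θ ^ p ∂μ) ^ (1 / p) ∂ν) ^ p := by
  have hp0 : 0 < p := one_pos.trans hp
  set S : X → ℝ≥0∞ := fun x => ∫⁻ θ, a x θ ∂ν with hS
  set R := ∫⁻ θ, (∫⁻ x, a x θ ^ p ∂μ) ^ (1 / p) ∂ν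
  have mS : Measurable S := ha.lintegral_prod_right'
  have hpq : p.HolderConjugate (p.conjExponent) := Real.HolderConjugate.conjExponent hp
  set q := p.conjExponent
  have step : ∀ n : ℕ, ∫⁻ x, (min (S x) n) ^ p ∂μ ≤ R ^ p := by
    intro n
    have mSn : Measurable fun x => min (S x) (n : ℝ≥0∞) := mS.min measurable_const
    set I := ∫⁻ x, (min (S x) n) ^ p ∂μ with hI
    have hfin : I ≠ ⊤ := by
      refine ne_top_of_le_ne_top (b := (n : ℝ≥0∞) ^ p * μ Set.univ) ?_ ?_
      · exact ENNReal.mul_ne_top (ENNReal.rpow_ne_top_of_nonneg hp0.le (ENNReal.natCast_ne_top n))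
          (measure_ne_top _ _)
      · rw [← lintegral_const]
        refine lintegral_mono fun x => ?_
        gcongr
        exact min_le_right _ _
    have h1 : I ≤ I ^ (1 / q) * R := by
      calc I ≤ ∫⁻ x, ∫⁻ θ, (min (S x) n) ^ (p - 1) * a x θ ∂ν ∂μ := by
            refine lintegral_mono fun x => ?_
            have hax : Measurable (a x) := ha.comp measurable_prodMk_left
            rw [lintegral_const_mul _ hax]
            calc (min (S x) (n : ℝ≥0∞)) ^ p
                = (min (S x) n) ^ (p - 1) * (min (S x) n) ^ (1 : ℝ) := by
                  rw [← ENNReal.rpow_add_of_nonneg _ _ (by linarith) zero_le_one, sub_add_cancel]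
              _ ≤ _ := by
                  rw [ENNReal.rpow_one]
                  gcongr
                  exact min_le_left _ _
        _ = ∫⁻ θ, ∫⁻ x, (min (S x) n) ^ (p - 1) * a x θ ∂μ ∂ν := by
            refine lintegral_lintegral_swap (Measurable.aemeasurable ?_)
            exact ((mSn.pow_const _).comp measurable_fst).mul ha
        _ ≤ ∫⁻ θ, I ^ (1 / q) * (∫⁻ x, a x θ ^ p ∂μ) ^ (1 / p) ∂ν := by
            refine lintegral_mono fun θ => ?_
            have := ENNReal.lintegral_mul_le_Lp_mul_Lq μ hpq.symm
              (mSn.pow_const (p - 1)).aemeasurable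
              (ha.comp (measurable_prodMk_right (y := θ))).aemeasurable
            refine this.trans_eq ?_
            congr 2
            refine lintegral_congr fun x => ?_
            rw [← ENNReal.rpow_mul, hpq.sub_one_mul_conj]
        _ = I ^ (1 / q) * R := by
            rw [lintegral_const_mul' _ _
              (ENNReal.rpow_ne_top_of_nonneg (one_div_nonneg.2 hpq.symm.nonneg) hfin)]
    rcases eq_or_ne I 0 with h0 | h0
    · rw [h0]; exact zero_le
    have h2 : I ^ (1 / q) * I ^ (1 / p) ≤ I ^ (1 / q) * R := by
      rw [← ENNReal.rpow_add _ _ h0 hfin,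
        show 1 / q + 1 / p = 1 by rw [one_div, one_div]; exact hpq.symm.inv_add_inv_eq_one,
        ENNReal.rpow_one]
      exact h1
    rw [ENNReal.mul_le_mul_iff_right
      (ENNReal.rpow_pos (pos_iff_ne_zero.2 h0) hfin).ne'
      (ENNReal.rpow_ne_top_of_nonneg (one_div_nonneg.2 hpq.symm.nonneg) hfin)] at h2
    calc I = (I ^ (1 / p)) ^ p := by
          rw [← ENNReal.rpow_mul, one_div_mul_cancel hp0.ne', ENNReal.rpow_one]
      _ ≤ R ^ p := by gcongr
  have hsup : ∀ x, S x ^ p = ⨆ n : ℕ, (min (S x) n) ^ p := by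
    intro x
    refine le_antisymm ?_ (iSup_le fun n => by gcongr; exact min_le_left _ _)
    have ht : Filter.Tendsto (fun n : ℕ => (min (S x) (n : ℝ≥0∞)) ^ p) Filter.atTop
        (nhds (S x ^ p)) := by
      refine (ENNReal.continuous_rpow_const.tendsto _).comp ?_
      have := (tendsto_const_nhds (x := S x)).min ENNReal.tendsto_nat_nhds_top
      simpa using this
    exact le_of_tendsto' ht fun n => le_iSup (fun n : ℕ => (min (S x) (n : ℝ≥0∞)) ^ p) n
  change ∫⁻ x, S x ^ p ∂μ ≤ _
  rw [lintegral_congr hsup, lintegral_iSup (fun n => (mS.min measurable_const).pow_const p)]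
  · exact iSup_le step
  · intro m n hmn x
    dsimp only
    gcongr

end Minkowski

section CubeEstimate

variable {d : ℕ}

/-- The spatial cube `[-1,1]^d`. -/
def spatialCube (d : ℕ) : Set (EuclideanSpace ℝ (Fin d)) := {x | ∀ j, x j ∈ Set.Icc (-1 : ℝ) 1}

lemma measurableSet_spatialCube : MeasurableSet (spatialCube d) := by
  have : spatialCube d = ⋂ j, (fun x : EuclideanSpace ℝ (Fin d) => x j) ⁻¹' Set.Icc (-1 : ℝ) 1 := by
    ext x; simp [spatialCube]
  rw [this]
  exact MeasurableSet.iInter fun j => measurableSet_Icc.preimage (by fun_prop)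

lemma norm_sub_sq_le_of_mem_spatialCube {x y : EuclideanSpace ℝ (Fin d)}
    (hx : x ∈ spatialCube d) (hy : y ∈ spatialCube d) : ‖x - y‖ ^ 2 ≤ 4 * d := by
  rw [EuclideanSpace.real_norm_sq_eq]
  calc ∑ i, (x - y) i ^ 2 ≤ ∑ _i : Fin d, (4 : ℝ) := by
        refine Finset.sum_le_sum fun i _ => ?_
        obtain ⟨hx1, hx2⟩ := hx i
        obtain ⟨hy1, hy2⟩ := hy i
        rw [PiLp.sub_apply]
        nlinarith
    _ = 4 * d := by simp [mul_comm]

lemma volume_cubeQ0_lt_top : volume (cubeQ0 d) < ⊤ := by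
  have hc : IsCompact (Set.Icc (-4 : ℝ) 0 ×ˢ
      Metric.closedBall (0 : EuclideanSpace ℝ (Fin d)) (Real.sqrt (4 * d))) :=
    isCompact_Icc.prod (isCompact_closedBall _ _)
  refine (measure_mono ?_).trans_lt hc.measure_lt_top
  refine Set.prod_mono subset_rfl fun x hx => ?_
  have h0 : (0 : EuclideanSpace ℝ (Fin d)) ∈ spatialCube d := fun j => by simp
  rw [mem_closedBall_zero_iff]
  refine Real.le_sqrt_of_sq_le ?_
  simpa using norm_sub_sq_le_of_mem_spatialCube hx h0

/-- A lower bound for the heat kernel between two points of the cube, at times in `[1,13]`. -/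
noncomputable def cubeKernelBound (d : ℕ) : ℝ :=
  (4 * Real.pi * 13) ^ (-(d : ℝ) / 2) * Real.exp (-d)

lemma cubeKernelBound_pos (d : ℕ) : 0 < cubeKernelBound d := by
  unfold cubeKernelBound; positivity

lemma cubeKernelBound_le {t : ℝ} (h1 : 1 ≤ t) (h13 : t ≤ 13) {x y : EuclideanSpace ℝ (Fin d)}
    (hx : x ∈ spatialCube d) (hy : y ∈ spatialCube d) :
    cubeKernelBound d ≤ heatKernel d t (x - y) := by
  have ht : 0 < t := by linarith
  unfold cubeKernelBound heatKernel
  have hd : (0 : ℝ) ≤ d := Nat.cast_nonneg d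
  refine mul_le_mul ?_ (Real.exp_le_exp.2 ?_) (Real.exp_pos _).le (by positivity)
  · refine Real.rpow_le_rpow_of_nonpos (by positivity) (by gcongr) ?_
    linarith
  · rw [le_div_iff₀ (by positivity)]
    nlinarith [norm_sub_sq_le_of_mem_spatialCube hx hy]

variable {V : Type*} [NormedAddCommGroup V] [InnerProductSpace ℝ V] [CompleteSpace V]

/-- The constant of the local energy estimate for one partial derivative. -/
noncomputable def cubeEnergyConst (d : ℕ) : ℝ :=
  (1 / (2 * 2 ^ ((d : ℝ) / 2)) * cubeKernelBound d)⁻¹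

lemma cubeEnergyConst_pos (d : ℕ) : 0 < cubeEnergyConst d := by
  have := cubeKernelBound_pos d
  unfold cubeEnergyConst; positivity

lemma lintegral_cube_fderiv_heatOp_le {M : ℝ} (j : Fin d) {h : EuclideanSpace ℝ (Fin d) → V}
    (hh : StronglyMeasurable h) (hM : ∀ y, ‖h y‖ ≤ M) {x : EuclideanSpace ℝ (Fin d)}
    (hx : x ∈ spatialCube d) :
    ∫⁻ τ in Set.Ioo 0 12, ∫⁻ y in spatialCube d,
        ‖fderiv ℝ (heatOp d τ h) y (EuclideanSpace.single j 1)‖ₑ ^ 2 ≤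
      ENNReal.ofReal (cubeEnergyConst d) * maxX d (fun y => ‖h y‖ ^ 2) x := by
  have hc := cubeKernelBound_pos d
  set L := ∫⁻ τ in Set.Ioo (0 : ℝ) 12, ∫⁻ y in spatialCube d,
        ‖fderiv ℝ (heatOp d τ h) y (EuclideanSpace.single j 1)‖ₑ ^ 2
  have h1 : ENNReal.ofReal (cubeKernelBound d) * L ≤ ∫⁻ τ in Set.Ioo (0 : ℝ) 13,
      heatLInt d (13 - τ)
        (fun y => ‖fderiv ℝ (heatOp d τ h) y (EuclideanSpace.single j 1)‖ₑ ^ 2) x := by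
    rw [← lintegral_const_mul' _ _ ENNReal.ofReal_ne_top]
    refine le_trans (setLIntegral_mono' measurableSet_Ioo fun τ hτ => ?_)
      (lintegral_mono_set (Set.Ioo_subset_Ioo_right (by norm_num)))
    rw [← lintegral_const_mul' _ _ ENNReal.ofReal_ne_top]
    refine le_trans (setLIntegral_mono' measurableSet_spatialCube fun y hy => ?_)
      (setLIntegral_le_lintegral _ _)
    gcongr
    exact cubeKernelBound_le (by linarith [hτ.2]) (by linarith [hτ.1]) hx hy
  have h2 := lintegral_heatLInt_fderiv_heatOp_le (T := 13) j hh hM x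
  have h3 : heatLInt d 13 (fun y => ‖h y‖ₑ ^ 2) x ≤ maxX d (fun y => ‖h y‖ ^ 2) x := by
    refine le_trans (le_of_eq ?_)
      (heatLInt_le_maxX (by norm_num : (0 : ℝ) < 13) (hh.norm.measurable.pow_const 2) x)
    congr 1
    ext y
    rw [abs_of_nonneg (by positivity), ENNReal.ofReal_pow (norm_nonneg _), ofReal_norm]
  have h4 : ENNReal.ofReal (1 / (2 * 2 ^ ((d : ℝ) / 2)) * cubeKernelBound d) * L ≤
      maxX d (fun y => ‖h y‖ ^ 2) x := by
    rw [ENNReal.ofReal_mul (by positivity), mul_assoc]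
    exact le_trans (by gcongr) (h2.trans h3)
  have hpos : 0 < 1 / (2 * 2 ^ ((d : ℝ) / 2)) * cubeKernelBound d := by positivity
  rw [cubeEnergyConst, ENNReal.ofReal_inv_of_pos hpos]
  rw [mul_comm (ENNReal.ofReal _)⁻¹, ← div_eq_mul_inv, ENNReal.le_div_iff_mul_le
    (Or.inl (ENNReal.ofReal_pos.2 hpos).ne') (Or.inl ENNReal.ofReal_ne_top), mul_comm]
  exact h4

/-- The squared gradient of the heat extension, written with the differentiated kernel. -/
noncomputable def heatEnergy (d : ℕ) {V : Type*} [NormedAddCommGroup V] [NormedSpace ℝ V] (t : ℝ)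
    (k : EuclideanSpace ℝ (Fin d) → V) (x : EuclideanSpace ℝ (Fin d)) : ℝ≥0∞ :=
  ∑ j : Fin d, ‖∫ z, heatKernelDeriv d j t (x - z) • k z‖ₑ ^ 2

lemma ofReal_gradHeatNormSq {t M : ℝ} (ht : 0 < t) {k : EuclideanSpace ℝ (Fin d) → V}
    (hk : StronglyMeasurable k) (hM : ∀ y, ‖k y‖ ≤ M) (x : EuclideanSpace ℝ (Fin d)) :
    ENNReal.ofReal (gradHeatNormSq d t k x) = heatEnergy d t k x := by
  unfold gradHeatNormSq heatEnergy
  rw [ENNReal.ofReal_sum_of_nonneg fun _ _ => by positivity]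
  refine Finset.sum_congr rfl fun j _ => ?_
  rw [fderiv_heatOp_single ht hk hM, ENNReal.ofReal_pow (norm_nonneg _), ofReal_norm]

lemma measurable_heatKernelDeriv (j : Fin d) :
    Measurable fun q : ℝ × EuclideanSpace ℝ (Fin d) => heatKernelDeriv d j q.1 q.2 := by
  unfold heatKernelDeriv
  have := measurable_heatKernel_uncurry (d := d)
  have h2 : Measurable fun q : ℝ × EuclideanSpace ℝ (Fin d) => q.2 j := by fun_prop
  exact ((measurable_fst.const_mul 2).inv.neg).mul (h2.mul this)

lemma measurable_heatEnergy {W : Type*} [NormedAddCommGroup W] [NormedSpace ℝ W]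
    {f : ℝ → EuclideanSpace ℝ (Fin d) → ℝ → W}
    (hf : StronglyMeasurable
      fun q : ℝ × EuclideanSpace ℝ (Fin d) × ℝ => f q.1 q.2.1 q.2.2) :
    Measurable fun q : ℝ × ℝ × EuclideanSpace ℝ (Fin d) × ℝ =>
      heatEnergy d q.2.1 (fun z => f q.1 z q.2.2.2) q.2.2.1 := by
  unfold heatEnergy
  refine Finset.measurable_sum _ fun j _ => ?_
  refine Measurable.pow_const (StronglyMeasurable.enorm ?_) 2
  refine StronglyMeasurable.integral_prod_right
    (f := fun (q : ℝ × ℝ × EuclideanSpace ℝ (Fin d) × ℝ) z =>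
      heatKernelDeriv d j q.2.1 (q.2.2.1 - z) • f q.1 z q.2.2.2) ?_
  refine StronglyMeasurable.smul (Measurable.stronglyMeasurable ?_) ?_
  · exact (measurable_heatKernelDeriv j).comp
      (f := fun p : (ℝ × ℝ × EuclideanSpace ℝ (Fin d) × ℝ) × EuclideanSpace ℝ (Fin d) =>
        (p.1.2.1, p.1.2.2.1 - p.2)) (by fun_prop)
  · exact hf.comp_measurable
      (g := fun p : (ℝ × ℝ × EuclideanSpace ℝ (Fin d) × ℝ) × EuclideanSpace ℝ (Fin d) =>
        (p.1.1, p.2, p.1.2.2.2)) (by fun_prop)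

lemma measurable_heatKernelDeriv_integral (j : Fin d) {W : Type*} [NormedAddCommGroup W]
    [NormedSpace ℝ W] {h : EuclideanSpace ℝ (Fin d) → W} (hh : StronglyMeasurable h) :
    Measurable fun q : ℝ × EuclideanSpace ℝ (Fin d) =>
      ‖∫ z, heatKernelDeriv d j q.1 (q.2 - z) • h z‖ₑ ^ 2 := by
  refine Measurable.pow_const (StronglyMeasurable.enorm ?_) 2
  refine StronglyMeasurable.integral_prod_right
    (f := fun (q : ℝ × EuclideanSpace ℝ (Fin d)) z =>
      heatKernelDeriv d j q.1 (q.2 - z) • h z) ?_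
  refine StronglyMeasurable.smul (Measurable.stronglyMeasurable ?_) ?_
  · exact (measurable_heatKernelDeriv j).comp
      (f := fun p : (ℝ × EuclideanSpace ℝ (Fin d)) × EuclideanSpace ℝ (Fin d) =>
        (p.1.1, p.1.2 - p.2)) (by fun_prop)
  · exact hh.comp_measurable measurable_snd

lemma setLIntegral_cubeQ0_heatEnergy_le {s M : ℝ} (hs : s ∈ Set.Ioo (-12 : ℝ) 0)
    {h : EuclideanSpace ℝ (Fin d) → V} (hh : StronglyMeasurable h) (hM : ∀ y, ‖h y‖ ≤ M)
    {x : EuclideanSpace ℝ (Fin d)} (hx : x ∈ spatialCube d) :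
    ∫⁻ q in cubeQ0 d ∩ {q | s < q.1}, heatEnergy d (q.1 - s) h q.2 ≤
      ENNReal.ofReal (d * cubeEnergyConst d) * maxX d (fun y => ‖h y‖ ^ 2) x := by
  have mD := fun j : Fin d => measurable_heatKernelDeriv_integral j hh
  have mE : Measurable fun q : ℝ × EuclideanSpace ℝ (Fin d) => heatEnergy d q.1 h q.2 :=
    Finset.measurable_sum _ fun j _ => mD j
  have mI : ∀ j : Fin d, Measurable fun τ : ℝ => ∫⁻ y in spatialCube d,
      ‖∫ z, heatKernelDeriv d j τ (y - z) • h z‖ₑ ^ 2 := fun j => (mD j).lintegral_prod_right'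
  have mY : ∀ (τ : ℝ) (j : Fin d), Measurable fun y : EuclideanSpace ℝ (Fin d) =>
      ‖∫ z, heatKernelDeriv d j τ (y - z) • h z‖ₑ ^ 2 := fun τ j => by
    simpa only [Function.comp_def] using
      (mD j).comp (measurable_prodMk_left (x := τ) (β := EuclideanSpace ℝ (Fin d)))
  have hfd : ∀ j : Fin d, ∫⁻ τ in Set.Ioo (0 : ℝ) 12, ∫⁻ y in spatialCube d,
      ‖∫ z, heatKernelDeriv d j τ (y - z) • h z‖ₑ ^ 2 =
      ∫⁻ τ in Set.Ioo (0 : ℝ) 12, ∫⁻ y in spatialCube d,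
        ‖fderiv ℝ (heatOp d τ h) y (EuclideanSpace.single j 1)‖ₑ ^ 2 := by
    intro j
    refine setLIntegral_congr_fun measurableSet_Ioo fun τ hτ => ?_
    refine lintegral_congr fun y => ?_
    rw [fderiv_heatOp_single hτ.1 hh hM]
  have hsub : cubeQ0 d ∩ {q | s < q.1} ⊆ Set.Ioo s (s + 12) ×ˢ spatialCube d := by
    rintro ⟨t, y⟩ ⟨⟨h1, h2⟩, h3⟩
    have h3' : s < t := h3
    have h1' : t ≤ 0 := h1.2
    exact ⟨⟨h3', by linarith [hs.1]⟩, h2⟩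
  calc ∫⁻ q in cubeQ0 d ∩ {q | s < q.1}, heatEnergy d (q.1 - s) h q.2
      ≤ ∫⁻ q in Set.Ioo s (s + 12) ×ˢ spatialCube d, heatEnergy d (q.1 - s) h q.2 :=
        lintegral_mono_set hsub
    _ = ∫⁻ t in Set.Ioo s (s + 12), ∫⁻ y in spatialCube d, heatEnergy d (t - s) h y := by
        rw [Measure.volume_eq_prod, setLIntegral_prod]
        exact (mE.comp (f := fun q : ℝ × EuclideanSpace ℝ (Fin d) => (q.1 - s, q.2))
          (by fun_prop)).aemeasurable
    _ = ∫⁻ τ in Set.Ioo 0 12, ∫⁻ y in spatialCube d, heatEnergy d τ h y := by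
        rw [← lintegral_indicator measurableSet_Ioo, ← lintegral_indicator measurableSet_Ioo]
        rw [← lintegral_sub_right_eq_self ((Set.Ioo (0 : ℝ) 12).indicator _) s]
        refine lintegral_congr fun t => ?_
        simp only [Set.indicator, Set.mem_Ioo, sub_pos, sub_lt_iff_lt_add']
    _ = ∫⁻ τ in Set.Ioo 0 12, ∑ j : Fin d, ∫⁻ y in spatialCube d,
          ‖∫ z, heatKernelDeriv d j τ (y - z) • h z‖ₑ ^ 2 := by
        refine lintegral_congr fun τ => ?_
        exact lintegral_finsetSum _ fun j _ => mY τ j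
    _ = ∑ j : Fin d, ∫⁻ τ in Set.Ioo 0 12, ∫⁻ y in spatialCube d,
          ‖∫ z, heatKernelDeriv d j τ (y - z) • h z‖ₑ ^ 2 :=
        lintegral_finsetSum _ fun j _ => mI j
    _ ≤ ∑ _j : Fin d, ENNReal.ofReal (cubeEnergyConst d) * maxX d (fun y => ‖h y‖ ^ 2) x := by
        refine Finset.sum_le_sum fun j _ => ?_
        rw [hfd j]
        exact lintegral_cube_fderiv_heatOp_le j hh hM hx
    _ = _ := by
        rw [Finset.sum_const, Finset.card_univ, Fintype.card_fin, nsmul_eq_mul,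
          ENNReal.ofReal_mul (Nat.cast_nonneg d), ENNReal.ofReal_natCast, mul_assoc]

end CubeEstimate

section SquareFunction

variable {d : ℕ} {V : Type*} [NormedAddCommGroup V] [InnerProductSpace ℝ V] [CompleteSpace V]

lemma ofReal_integral_le_lintegral {X : Type*} [MeasurableSpace X] (μ : Measure X) {g : X → ℝ}
    (hg : ∀ x, 0 ≤ g x) : ENNReal.ofReal (∫ x, g x ∂μ) ≤ ∫⁻ x, ENNReal.ofReal (g x) ∂μ := by
  by_cases hi : Integrable g μ
  · exact (ofReal_integral_eq_lintegral_ofReal hi (Filter.Eventually.of_forall hg)).le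
  · simp [integral_undef hi]

lemma gradHeatNormSq_nonneg (t : ℝ) (k : EuclideanSpace ℝ (Fin d) → V)
    (x : EuclideanSpace ℝ (Fin d)) : 0 ≤ gradHeatNormSq d t k x :=
  Finset.sum_nonneg fun _ _ => by positivity

lemma ofReal_calG_sq_le {H : ℝ} (hH : 0 < H) {α β : EReal}
    {f : ℝ → EuclideanSpace ℝ (Fin d) → ℝ → V}
    (hf : ∀ s θ, StronglyMeasurable fun y => f s y θ)
    (hM : ∀ s θ, ∃ M, ∀ y, ‖f s y θ‖ ≤ M) (t : ℝ) (x : EuclideanSpace ℝ (Fin d)) :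
    ENNReal.ofReal (calG d H α β f t x ^ 2) ≤
      ∫⁻ s in Set.Iio t, (∫⁻ θ in {θ : ℝ | α < (θ : EReal) ∧ (θ : EReal) < β},
        heatEnergy d (t - s) (fun y => f s y θ) x ^ (1 / (2 * H))) ^ (2 * H) := by
  have hin : ∀ s θ, 0 ≤ gradHeatNormSq d (t - s) (fun y => f s y θ) x ^ (1 / (2 * H)) :=
    fun s θ => Real.rpow_nonneg (gradHeatNormSq_nonneg _ _ _) _
  have hmid : ∀ s, 0 ≤ ∫ θ in {θ : ℝ | α < (θ : EReal) ∧ (θ : EReal) < β},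
      gradHeatNormSq d (t - s) (fun y => f s y θ) x ^ (1 / (2 * H)) :=
    fun s => integral_nonneg fun θ => hin s θ
  have hout : ∀ s, 0 ≤ (∫ θ in {θ : ℝ | α < (θ : EReal) ∧ (θ : EReal) < β},
      gradHeatNormSq d (t - s) (fun y => f s y θ) x ^ (1 / (2 * H))) ^ (2 * H) :=
    fun s => Real.rpow_nonneg (hmid s) _
  rw [calG, ← Real.rpow_natCast, ← Real.rpow_mul (integral_nonneg hout)]
  norm_num only [Nat.cast_ofNat, Real.rpow_one]
  refine (ofReal_integral_le_lintegral _ hout).trans ?_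
  refine setLIntegral_mono' measurableSet_Iio fun s hs => ?_
  rw [← ENNReal.ofReal_rpow_of_nonneg (hmid s) (by positivity)]
  gcongr
  refine (ofReal_integral_le_lintegral _ (hin s)).trans (lintegral_mono fun θ => ?_)
  obtain ⟨M, hM⟩ := hM s θ
  rw [← ENNReal.ofReal_rpow_of_nonneg (gradHeatNormSq_nonneg _ _ _) (by positivity),
    ofReal_gradHeatNormSq (sub_pos.2 hs) (hf s θ) hM]

/-- The contribution of a single source time `s` to the local energy. -/
lemma setLIntegral_cubeQ0_slice_le {H : ℝ} (hH : H ∈ Set.Ioo (1 / 2 : ℝ) 1) {α β : EReal}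
    {f : ℝ → EuclideanSpace ℝ (Fin d) → ℝ → V}
    (hfm : StronglyMeasurable
      fun q : ℝ × EuclideanSpace ℝ (Fin d) × ℝ => f q.1 q.2.1 q.2.2)
    (hf : ∀ s θ, StronglyMeasurable fun y => f s y θ)
    (hM : ∀ s θ, ∃ M, ∀ y, ‖f s y θ‖ ≤ M)
    {x : EuclideanSpace ℝ (Fin d)} (hx : x ∈ spatialCube d) {s : ℝ}
    (hs : s ∈ Set.Ioo (-12 : ℝ) 0) :
    ∫⁻ q in cubeQ0 d ∩ {q | s < q.1}, (∫⁻ θ in {θ : ℝ | α < (θ : EReal) ∧ (θ : EReal) < β},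
        heatEnergy d (q.1 - s) (fun y => f s y θ) q.2 ^ (1 / (2 * H))) ^ (2 * H) ≤
      ENNReal.ofReal (d * cubeEnergyConst d) * Ff d H α β f s x := by
  have hH0 : 0 < H := by linarith [hH.1]
  have h2H : 1 < 2 * H := by linarith [hH.1]
  have : IsFiniteMeasure ((volume : Measure (ℝ × EuclideanSpace ℝ (Fin d))).restrict
      (cubeQ0 d ∩ {q | s < q.1})) := by
    rw [isFiniteMeasure_restrict]
    exact ((measure_mono Set.inter_subset_left).trans_lt volume_cubeQ0_lt_top).ne
  have mE : Measurable (Function.uncurry fun (q : ℝ × EuclideanSpace ℝ (Fin d)) (θ : ℝ) =>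
      heatEnergy d (q.1 - s) (fun y => f s y θ) q.2 ^ (1 / (2 * H))) := by
    have := (measurable_heatEnergy hfm).comp
      (f := fun q : (ℝ × EuclideanSpace ℝ (Fin d)) × ℝ => (s, q.1.1 - s, q.1.2, q.2))
      (by fun_prop)
    simpa only [Function.comp_def, Function.uncurry_def] using this.pow_const (1 / (2 * H))
  refine (lintegral_minkowski (volume.restrict (cubeQ0 d ∩ {q | s < q.1}))
    (volume.restrict {θ : ℝ | α < (θ : EReal) ∧ (θ : EReal) < β}) h2H mE).trans ?_
  have hC : ENNReal.ofReal (d * cubeEnergyConst d) * Ff d H α β f s x =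
      (∫⁻ θ in {θ : ℝ | α < (θ : EReal) ∧ (θ : EReal) < β},
        (ENNReal.ofReal (d * cubeEnergyConst d) * maxX d (fun y => ‖f s y θ‖ ^ 2) x) ^
          (1 / (2 * H))) ^ (2 * H) := by
    simp_rw [ENNReal.mul_rpow_of_nonneg _ _ (show 0 ≤ 1 / (2 * H) by positivity)]
    rw [lintegral_const_mul' _ _
        (ENNReal.rpow_ne_top_of_nonneg (by positivity) ENNReal.ofReal_ne_top),
      ENNReal.mul_rpow_of_nonneg _ _ (by positivity), ← ENNReal.rpow_mul,
      one_div_mul_cancel (by positivity), ENNReal.rpow_one, Ff]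
  rw [hC]
  gcongr with θ
  obtain ⟨M, hM⟩ := hM s θ
  have hroot : ∀ a : ℝ≥0∞, (a ^ (1 / (2 * H))) ^ (2 * H) = a := fun a => by
    rw [← ENNReal.rpow_mul, one_div_mul_cancel (by positivity), ENNReal.rpow_one]
  simp only [hroot]
  exact setLIntegral_cubeQ0_heatEnergy_le (h := fun y => f s y θ) hs (hf s θ) hM hx

lemma heatEnergy_zero {W : Type*} [NormedAddCommGroup W] [NormedSpace ℝ W] (t : ℝ)
    (x : EuclideanSpace ℝ (Fin d)) : heatEnergy d t (fun _ => (0 : W)) x = 0 := by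
  simp [heatEnergy]

lemma lintegral_cubeQ0_calG_sq_le {H : ℝ} (hH : H ∈ Set.Ioo (1 / 2 : ℝ) 1) {α β : EReal}
    {f : ℝ → EuclideanSpace ℝ (Fin d) → ℝ → V}
    (hfm : StronglyMeasurable
      fun q : ℝ × EuclideanSpace ℝ (Fin d) × ℝ => f q.1 q.2.1 q.2.2)
    (hf : ∀ s θ, StronglyMeasurable fun y => f s y θ)
    (hM : ∀ s θ, ∃ M, ∀ y, ‖f s y θ‖ ≤ M)
    (h0 : ∀ s y θ, s ∉ Set.Ioo (-12 : ℝ) 12 → f s y θ = 0)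
    {x : EuclideanSpace ℝ (Fin d)} (hx : x ∈ spatialCube d) :
    ∫⁻ q in cubeQ0 d, ENNReal.ofReal (calG d H α β f q.1 q.2 ^ 2) ≤
      ENNReal.ofReal (d * cubeEnergyConst d) *
        ∫⁻ s in Set.Ioo (-12 : ℝ) 0, Ff d H α β f s x := by
  have hH0 : 0 < H := by linarith [hH.1]
  set Φ : ℝ → ℝ × EuclideanSpace ℝ (Fin d) → ℝ≥0∞ := fun s q =>
    (∫⁻ θ in {θ : ℝ | α < (θ : EReal) ∧ (θ : EReal) < β},
        heatEnergy d (q.1 - s) (fun y => f s y θ) q.2 ^ (1 / (2 * H))) ^ (2 * H) with hΦ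
  have mΦ : Measurable fun p : (ℝ × EuclideanSpace ℝ (Fin d)) × ℝ => Φ p.2 p.1 := by
    have h1 := (measurable_heatEnergy hfm).comp
      (f := fun q : ((ℝ × EuclideanSpace ℝ (Fin d)) × ℝ) × ℝ =>
        (q.1.2, q.1.1.1 - q.1.2, q.1.1.2, q.2)) (by fun_prop)
    have h2 : Measurable fun q : ((ℝ × EuclideanSpace ℝ (Fin d)) × ℝ) × ℝ =>
        heatEnergy d (q.1.1.1 - q.1.2) (fun y => f q.1.2 y q.2) q.1.1.2 ^ (1 / (2 * H)) := by
      simpa only [Function.comp_def] using h1.pow_const (1 / (2 * H))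
    exact h2.lintegral_prod_right'.pow_const _
  have mS : MeasurableSet {p : (ℝ × EuclideanSpace ℝ (Fin d)) × ℝ | p.2 < p.1.1} :=
    measurableSet_lt measurable_snd measurable_fst.fst
  have mS' : ∀ s : ℝ, MeasurableSet {q : ℝ × EuclideanSpace ℝ (Fin d) | s < q.1} :=
    fun s => measurableSet_lt measurable_const measurable_fst
  calc ∫⁻ q in cubeQ0 d, ENNReal.ofReal (calG d H α β f q.1 q.2 ^ 2)
      ≤ ∫⁻ q in cubeQ0 d, ∫⁻ s, Set.indicator {p : (ℝ × EuclideanSpace ℝ (Fin d)) × ℝ |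
          p.2 < p.1.1} (fun p => Φ p.2 p.1) (q, s) := by
        refine lintegral_mono fun q => ?_
        refine (ofReal_calG_sq_le hH0 hf hM q.1 q.2).trans (le_of_eq ?_)
        rw [← lintegral_indicator measurableSet_Iio]
        rfl
    _ = ∫⁻ s, ∫⁻ q in cubeQ0 d, Set.indicator {p : (ℝ × EuclideanSpace ℝ (Fin d)) × ℝ |
          p.2 < p.1.1} (fun p => Φ p.2 p.1) (q, s) :=
        lintegral_lintegral_swap (mΦ.indicator mS).aemeasurable
    _ = ∫⁻ s, ∫⁻ q in cubeQ0 d ∩ {q | s < q.1}, Φ s q := by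
        refine lintegral_congr fun s => ?_
        rw [Set.inter_comm, ← Measure.restrict_restrict (mS' s),
          ← lintegral_indicator (mS' s)]
        rfl
    _ ≤ ∫⁻ s, (Set.Ioo (-12 : ℝ) 0).indicator
          (fun s => ENNReal.ofReal (d * cubeEnergyConst d) * Ff d H α β f s x) s := by
        refine lintegral_mono fun s => ?_
        by_cases hs : s ∈ Set.Ioo (-12 : ℝ) 0
        · rw [Set.indicator_of_mem hs]
          exact setLIntegral_cubeQ0_slice_le hH hfm hf hM hx hs
        · rw [Set.indicator_of_notMem hs]
          rcases le_or_gt 0 s with h | h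
          · have : cubeQ0 d ∩ {q | s < q.1} = ∅ := by
              ext ⟨t, y⟩
              simp only [cubeQ0, Set.mem_inter_iff, Set.mem_prod, Set.mem_Icc,
                Set.mem_ofPred_eq, Set.mem_empty_iff_false, iff_false]
              rintro ⟨⟨⟨-, h1⟩, -⟩, h2⟩
              linarith
            simp [this]
          · have hs' : s ∉ Set.Ioo (-12 : ℝ) 12 := fun h' => hs ⟨h'.1, h⟩
            have hz : ∀ θ, (fun y => f s y θ) = fun _ => (0 : V) :=
              fun θ => funext fun y => h0 s y θ hs'
            have : ∀ q, Φ s q = 0 := fun q => by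
              simp [hΦ, hz, heatEnergy_zero, hH0]
            simp [this]
    _ = _ := by
        rw [lintegral_indicator measurableSet_Ioo, lintegral_const_mul' _ _ ENNReal.ofReal_ne_top]

lemma setLIntegral_Ioo_le_maxT (k : ℝ → ℝ≥0∞) (t : ℝ) {r : ℝ} (hr : 0 < r) :
    ∫⁻ s in Set.Ioo (t - r) (t + r), k s ≤ ENNReal.ofReal (2 * r) * maxT k t := by
  have h := le_iSup₂ (f := fun (r : ℝ) (_ : 0 < r) =>
    (ENNReal.ofReal (2 * r))⁻¹ * ∫⁻ s in Set.Ioo (t - r) (t + r), k s) r hr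
  have hp : 0 < 2 * r := by positivity
  calc ∫⁻ s in Set.Ioo (t - r) (t + r), k s
      = ENNReal.ofReal (2 * r) * ((ENNReal.ofReal (2 * r))⁻¹ *
          ∫⁻ s in Set.Ioo (t - r) (t + r), k s) := by
        rw [← mul_assoc, ENNReal.mul_inv_cancel (ENNReal.ofReal_pos.2 hp).ne'
          ENNReal.ofReal_ne_top, one_mul]
    _ ≤ _ := by
        gcongr
        exact h

end SquareFunction

/-- If `f(t,x,θ) = 0` for `t ∉ (-12,12)`, then for every
`(t,x) ∈ Q₀`, `∫_{Q₀} |𝒢f(s,y)|² ds dy ≤ N 𝕄_t[F_f(·,x)](t)`, with `N = N(d)`. -/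
theorem calG_L2_bound_time_support (d : ℕ) (hd : 1 ≤ d) :
    ∃ N : ℝ, 0 < N ∧
      ∀ (V : Type) [NormedAddCommGroup V] [InnerProductSpace ℝ V] [CompleteSpace V]
        [TopologicalSpace.SeparableSpace V]
        (H : ℝ), H ∈ Set.Ioo (1/2 : ℝ) 1 →
      ∀ (α β : EReal), α < β →
      ∀ (f : ℝ → EuclideanSpace ℝ (Fin d) → ℝ → V),
        StronglyMeasurable
          (fun q : ℝ × EuclideanSpace ℝ (Fin d) × ℝ => f q.1 q.2.1 q.2.2) →
        (∀ θ, ContDiff ℝ (⊤ : ℕ∞)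
          (fun q : ℝ × EuclideanSpace ℝ (Fin d) => f q.1 q.2 θ)) →
        (∃ K : Set (ℝ × EuclideanSpace ℝ (Fin d)), IsCompact K ∧
          ∀ θ, tsupport (fun q : ℝ × EuclideanSpace ℝ (Fin d) => f q.1 q.2 θ) ⊆ K) →
        (∀ (t : ℝ) (x : EuclideanSpace ℝ (Fin d)) (θ : ℝ),
          t ∉ Set.Ioo (-12 : ℝ) 12 → f t x θ = 0) →
        ∀ (t : ℝ) (x : EuclideanSpace ℝ (Fin d)), (t, x) ∈ cubeQ0 d →
        ENNReal.ofReal (∫ q in cubeQ0 d, (calG d H α β f q.1 q.2)^2) ≤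
          ENNReal.ofReal N * maxT (fun s => Ff d H α β f s x) t := by
  have hC : 0 < (d : ℝ) * cubeEnergyConst d :=
    mul_pos (by exact_mod_cast hd) (cubeEnergyConst_pos d)
  refine ⟨d * cubeEnergyConst d * (2 * 13), by positivity, ?_⟩
  intro V _ _ _ _ H hH α β _ f hfm hsm hK h0 t x htx
  have hcont : ∀ s θ, Continuous fun y => f s y θ := fun s θ =>
    (hsm θ).continuous.comp (Continuous.prodMk_right s)
  have hM : ∀ s θ, ∃ M, ∀ y, ‖f s y θ‖ ≤ M := by
    intro s θ
    obtain ⟨K, hKc, hKs⟩ := hK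
    obtain ⟨M, hM⟩ := (hsm θ).continuous.bounded_above_of_compact_support
      (hKc.of_isClosed_subset (isClosed_tsupport _) (hKs θ))
    exact ⟨M, fun y => hM (s, y)⟩
  have hf : ∀ s θ, StronglyMeasurable fun y => f s y θ := fun s θ =>
    (hcont s θ).stronglyMeasurable
  have ht : t ∈ Set.Icc (-4 : ℝ) 0 := htx.1
  calc ENNReal.ofReal (∫ q in cubeQ0 d, (calG d H α β f q.1 q.2) ^ 2)
      ≤ ∫⁻ q in cubeQ0 d, ENNReal.ofReal (calG d H α β f q.1 q.2 ^ 2) :=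
        ofReal_integral_le_lintegral _ fun _ => sq_nonneg _
    _ ≤ ENNReal.ofReal (d * cubeEnergyConst d) *
          ∫⁻ s in Set.Ioo (-12 : ℝ) 0, Ff d H α β f s x :=
        lintegral_cubeQ0_calG_sq_le hH hfm hf hM h0 htx.2
    _ ≤ ENNReal.ofReal (d * cubeEnergyConst d) *
          ∫⁻ s in Set.Ioo (t - 13) (t + 13), Ff d H α β f s x := by
        gcongr <;> linarith [ht.1, ht.2]
    _ ≤ ENNReal.ofReal (d * cubeEnergyConst d) *
          (ENNReal.ofReal (2 * 13) * maxT (fun s => Ff d H α β f s x) t) := by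
        gcongr
        exact setLIntegral_Ioo_le_maxT _ t (by norm_num)
    _ = _ := by rw [ENNReal.ofReal_mul hC.le, mul_assoc]
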